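/- arXiv:1312.6436 — 4 statements merged into one kernel-verified Lean document; each statement's English description precedes it below -/
import Mathlib

section
/- Let V be a finite-dimensional real vector space and let L ⊆ V ⊕ V* be a subspace that is isotropic (L ⊆ L^⊥) for the pairing ⟨(X,α),(Y,β)⟩ = β(X) + α(Y) and satisfies L^⊥ ∩ (V ⊕ {0}) = {0}. Then pr₂(L) = V* and L = L^⊥. -/
/-- The symmetric pairing `⟨(X,α),(Y,β)⟩ = β(X) + α(Y)` on `V ⊕ V*`. -/
def pairD {V : Type*} [AddCommGroup V] [Module ℝ V]
    (w₁ w₂ : V × Module.Dual ℝ V) : ℝ :=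
  w₂.2 w₁.1 + w₁.2 w₂.1

/-- The orthogonal of a subspace `L ⊆ V ⊕ V*` with respect to the pairing. -/
def perpD {V : Type*} [AddCommGroup V] [Module ℝ V]
    (L : Submodule ℝ (V × Module.Dual ℝ V)) : Set (V × Module.Dual ℝ V) :=
  {w | ∀ l ∈ L, pairD w l = 0}

/-- If `L ⊆ V ⊕ V*` is isotropic and `L^⊥ ∩ (V ⊕ {0}) = {0}`, then
`pr₂(L) = V*` and `L = L^⊥`. -/
theorem isotropic_nondegenerate_implies_lagrangian
    {V : Type*} [AddCommGroup V] [Module ℝ V] [FiniteDimensional ℝ V]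
    (L : Submodule ℝ (V × Module.Dual ℝ V))
    (hiso : (L : Set (V × Module.Dual ℝ V)) ⊆ perpD L)
    (hnondeg : ∀ X : V, (X, (0 : Module.Dual ℝ V)) ∈ perpD L → X = 0) :
    (∀ β : Module.Dual ℝ V, ∃ w ∈ L, w.2 = β) ∧
      (L : Set (V × Module.Dual ℝ V)) = perpD L := by
  have hsurj : ∀ β : Module.Dual ℝ V, ∃ w ∈ L, w.2 = β := by
    have hbot : (L.map (LinearMap.snd ℝ V (Module.Dual ℝ V))).dualCoannihilator = ⊥ := by
      refine (Submodule.eq_bot_iff _).2 fun X hX => hnondeg X fun l hl => ?_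
      have h : l.2 X = 0 :=
        (Submodule.mem_dualCoannihilator X).1 hX l.2 (Submodule.mem_map_of_mem hl)
      simp [pairD, h]
    have htop : L.map (LinearMap.snd ℝ V (Module.Dual ℝ V)) = ⊤ := by
      rw [← Subspace.dualCoannihilator_dualAnnihilator_eq
        (W := L.map (LinearMap.snd ℝ V (Module.Dual ℝ V))), hbot,
        Submodule.dualAnnihilator_bot]
    intro β
    exact Submodule.mem_map.1 (htop ▸ Submodule.mem_top : β ∈ L.map (LinearMap.snd ℝ V _))
  refine ⟨hsurj, hiso.antisymm ?_⟩
  rintro ⟨X, α⟩ hw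
  obtain ⟨⟨Y, _⟩, hY, rfl⟩ := hsurj α
  have hXY : X - Y = 0 := hnondeg _ fun l hl => by
    have h₁ := hw l hl
    have h₂ := hiso hY l hl
    simp only [pairD, map_sub, LinearMap.zero_apply] at h₁ h₂ ⊢
    linarith
  rwa [sub_eq_zero.1 hXY]
end

section
/- Let V be a finite-dimensional real vector space and k ≥ 1. A subspace L ⊆ W^{(k)} = V ⊕ Ω^k(V) is isotropic and satisfies L^⊥ ∩ V = {0} if and only if there exist a subspace D ⊆ Ω^k(V) and a linear map λ : D → V such that (a) D° = {0}, (b) ι_{λ(α)} β = −ι_{λ(β)} α for all α, β ∈ D, and L = {(λ(α), α) : α ∈ D}. In this case D = pr₂(L), the map pr₂|_L : L → Ω^k(V) is injective, and λ = pr₁ ∘ (pr₂|_L)^{−1}. -/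
/-- `Ω^k(V)`: alternating `k`-linear maps `V^k → ℝ`. -/
abbrev Form (V : Type*) [AddCommGroup V] [Module ℝ V] (k : ℕ) :=
  AlternatingMap ℝ V ℝ (Fin k)

/-- Interior product `ι_X α`. -/
noncomputable def iota {V : Type*} [AddCommGroup V] [Module ℝ V] {k : ℕ}
    (X : V) (α : Form V (k + 1)) : Form V k :=
  α.curryLeft X

/-- The `Ω^{k-1}(V)`-valued symmetric pairing on `W^(k) = V ⊕ Ω^k(V)`. -/
noncomputable def pairW {V : Type*} [AddCommGroup V] [Module ℝ V] {k : ℕ}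
    (w₁ w₂ : V × Form V (k + 1)) : Form V k :=
  iota w₁.1 w₂.2 + iota w₂.1 w₁.2

/-- The orthogonal `L^⊥` of a subspace `L ⊆ W^(k)` with respect to the pairing. -/
def perp {V : Type*} [AddCommGroup V] [Module ℝ V] {k : ℕ}
    (L : Submodule ℝ (V × Form V (k + 1))) : Set (V × Form V (k + 1)) :=
  {w | ∀ l ∈ L, pairW w l = 0}

theorem pairW_mk_zero_left {V : Type*} [AddCommGroup V] [Module ℝ V] {k : ℕ}
    (X : V) (w : V × Form V (k + 1)) : pairW (X, 0) w = iota X w.2 := by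
  simp [pairW, iota]

theorem mk_zero_mem_perp_iff {V : Type*} [AddCommGroup V] [Module ℝ V] {k : ℕ}
    (L : Submodule ℝ (V × Form V (k + 1))) (X : V) :
    (X, (0 : Form V (k + 1))) ∈ perp L ↔ ∀ w ∈ L, iota X w.2 = 0 := by
  simp only [perp, Set.mem_ofPred_eq, pairW_mk_zero_left]

theorem eq_of_snd_eq_of_isotropic {V : Type*} [AddCommGroup V] [Module ℝ V] {k : ℕ}
    {L : Submodule ℝ (V × Form V (k + 1))}
    (hL : (L : Set (V × Form V (k + 1))) ⊆ perp L)
    (hV : ∀ X : V, (X, (0 : Form V (k + 1))) ∈ perp L → X = 0)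
    {w₁ w₂ : V × Form V (k + 1)} (h₁ : w₁ ∈ L) (h₂ : w₂ ∈ L) (h : w₁.2 = w₂.2) :
    w₁ = w₂ := by
  have hmem : w₁ - w₂ ∈ perp L := hL (L.sub_mem h₁ h₂)
  have heq : w₁ - w₂ = (w₁.1 - w₂.1, 0) := Prod.ext rfl (sub_eq_zero.2 h)
  rw [heq] at hmem
  exact Prod.ext (sub_eq_zero.1 (hV _ hmem)) h

/-- A subspace `L ⊆ W^(k) = V ⊕ Ω^k(V)` (`k = n + 1 ≥ 1`) is isotropic
with `L^⊥ ∩ V = {0}` iff it is the graph of a map `λ : D → V` defined on a subspace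
`D ⊆ Ω^k(V)` with `D° = {0}` and `ι_{λ(α)} β = −ι_{λ(β)} α`.  In this case
`D = pr₂(L)`, `pr₂|_L` is injective, and `λ = pr₁ ∘ (pr₂|_L)⁻¹`. -/
theorem kPoisson_iff_pair_D_lambda
    {V : Type*} [AddCommGroup V] [Module ℝ V] [FiniteDimensional ℝ V]
    {n : ℕ} (L : Submodule ℝ (V × Form V (n + 1))) :
    (((L : Set (V × Form V (n + 1))) ⊆ perp L ∧
        (∀ X : V, (X, (0 : Form V (n + 1))) ∈ perp L → X = 0)) ↔
      (∃ (D : Submodule ℝ (Form V (n + 1))) (lam : D →ₗ[ℝ] V),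
        (∀ X : V, (∀ α ∈ D, iota X α = 0) → X = 0) ∧
        (∀ α β : D, iota (lam α) (β : Form V (n + 1)) =
          -iota (lam β) (α : Form V (n + 1))) ∧
        (L : Set (V × Form V (n + 1))) =
          {w | ∃ α : D, w = (lam α, (α : Form V (n + 1)))})) ∧
    (((L : Set (V × Form V (n + 1))) ⊆ perp L ∧
        (∀ X : V, (X, (0 : Form V (n + 1))) ∈ perp L → X = 0)) →
      ((∀ w₁ ∈ L, ∀ w₂ ∈ L, (w₁ : V × Form V (n + 1)).2 = w₂.2 → w₁ = w₂) ∧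
        (∀ (D : Submodule ℝ (Form V (n + 1))) (lam : D →ₗ[ℝ] V),
          (∀ X : V, (∀ α ∈ D, iota X α = 0) → X = 0) →
          (∀ α β : D, iota (lam α) (β : Form V (n + 1)) =
            -iota (lam β) (α : Form V (n + 1))) →
          (L : Set (V × Form V (n + 1))) =
            {w | ∃ α : D, w = (lam α, (α : Form V (n + 1)))} →
          ((D : Set (Form V (n + 1))) = Prod.snd '' (L : Set (V × Form V (n + 1))) ∧
            ∀ (α : D) (w : V × Form V (n + 1)), w ∈ L →
              w.2 = (α : Form V (n + 1)) → lam α = w.1)))) := by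
  refine ⟨⟨?_, ?_⟩, ?_⟩
  · rintro ⟨hL, hV⟩
    let p : L →ₗ[ℝ] Form V (n + 1) := (LinearMap.snd ℝ V (Form V (n + 1))).domRestrict L
    have hp : Function.Injective p := fun a b h =>
      Subtype.ext (eq_of_snd_eq_of_isotropic hL hV a.2 b.2 h)
    let e := LinearEquiv.ofInjective p hp
    have he : ∀ α : LinearMap.range p, ((e.symm α : L) : V × Form V (n + 1)).2 = α :=
      fun α => congrArg Subtype.val (e.apply_symm_apply α)
    refine ⟨LinearMap.range p,
      (LinearMap.fst ℝ V (Form V (n + 1))).domRestrict L ∘ₗ e.symm.toLinearMap, ?_, ?_, ?_⟩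
    · intro X hX
      exact hV X ((mk_zero_mem_perp_iff L X).2 fun w hw => hX _ ⟨⟨w, hw⟩, rfl⟩)
    · intro α β
      have h := hL (e.symm α).2 _ (e.symm β).2
      rw [pairW, he, he] at h
      exact eq_neg_of_add_eq_zero_left h
    · ext w
      constructor
      · intro hw
        refine ⟨e ⟨w, hw⟩, Prod.ext ?_ rfl⟩
        simp
      · rintro ⟨α, rfl⟩
        have h := (e.symm α).2
        rwa [← Prod.mk.eta (p := ((e.symm α : L) : V × Form V (n + 1))), he] at h
  · rintro ⟨D, lam, hD, hlam, hL⟩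
    have hgraph : ∀ w, w ∈ L ↔ ∃ α : D, w = (lam α, (α : Form V (n + 1))) := fun w =>
      Set.ext_iff.1 hL w
    refine ⟨fun w hw l hl => ?_, fun X hX => hD X fun α hα => ?_⟩
    · obtain ⟨α, rfl⟩ := (hgraph w).1 hw
      obtain ⟨β, rfl⟩ := (hgraph l).1 hl
      simp only [pairW, hlam α β, neg_add_cancel]
    · exact (mk_zero_mem_perp_iff L X).1 hX _ ((hgraph _).2 ⟨⟨α, hα⟩, rfl⟩)
  · rintro ⟨hL, hV⟩
    refine ⟨fun w₁ h₁ w₂ h₂ h => eq_of_snd_eq_of_isotropic hL hV h₁ h₂ h, ?_⟩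
    intro D lam _ _ hgraph
    rw [hgraph]
    refine ⟨?_, ?_⟩
    · ext α
      constructor
      · exact fun hα => ⟨_, ⟨⟨α, hα⟩, rfl⟩, rfl⟩
      · rintro ⟨_, ⟨β, rfl⟩, rfl⟩
        exact β.2
    · intro α w hw h
      obtain ⟨β, rfl⟩ := (Set.ext_iff.1 hgraph w).1 hw
      exact congrArg lam (Subtype.ext h.symm)
end

section
/- Let V be a finite-dimensional real vector space, k ≥ 1, D ⊆ Ω^k(V) a subspace, and λ : D → V a linear map satisfying ι_{λ(α)} β = −ι_{λ(β)} α for all α, β ∈ D. Let S := λ(D) ⊆ V. Then there exists a unique alternating (k+1)-linear map ω : S^{k+1} → ℝ such that ω(λ(α), Y₁, …, Y_k) = α(Y₁, …, Y_k) for all α ∈ D and Y₁, …, Y_k ∈ S. In particular, if λ(α) = λ(α′) for α, α′ ∈ D, then α and α′ agree on all k-tuples of vectors from S. -/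
/-- If `ι_X α = 0`, then `α` vanishes on every tuple having `X` among its entries. -/
theorem eq_zero_of_iota_eq_zero {V : Type*} [AddCommGroup V] [Module ℝ V] {n : ℕ}
    {α : Form V (n + 1)} {X : V} (h : iota X α = 0) {Y : Fin (n + 1) → V}
    {j : Fin (n + 1)} (hj : Y j = X) : α Y = 0 := by
  have h0 : α (Y ∘ Equiv.swap 0 j) = 0 := by
    have h1 := DFunLike.congr_fun h (Fin.tail (Y ∘ Equiv.swap 0 j))
    rw [iota, AlternatingMap.curryLeft_apply_apply] at h1
    rw [← Fin.cons_self_tail (Y ∘ Equiv.swap 0 j)]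
    simpa [hj, Matrix.vecCons] using h1
  rw [AlternatingMap.map_perm] at h0
  exact (smul_eq_zero_iff_eq _).mp h0

/-- If `ι_{λ(α)} β = −ι_{λ(β)} α` on `D`, then a form in the kernel of `λ` vanishes on tuples
of vectors from the range of `λ`. -/
theorem eq_zero_of_mem_ker {V : Type*} [AddCommGroup V] [Module ℝ V] {n : ℕ}
    {D : Submodule ℝ (Form V (n + 1))} {lam : D →ₗ[ℝ] V}
    (hskew : ∀ α β : D, iota (lam α) (β : Form V (n + 1)) =
      -iota (lam β) (α : Form V (n + 1)))
    {α : D} (hα : lam α = 0) (Y : Fin (n + 1) → LinearMap.range lam) :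
    (α : Form V (n + 1)) (fun i => (Y i : V)) = 0 := by
  obtain ⟨β, hβ⟩ := (Y 0).2
  refine eq_zero_of_iota_eq_zero (X := lam β) (j := 0) ?_ hβ.symm
  rw [hskew β α, hα, iota, map_zero, neg_zero]


/-- Given a subspace `D ⊆ Ω^k(V)` (`k = n + 1 ≥ 1`) and a linear map
`λ : D → V` with `ι_{λ(α)} β = −ι_{λ(β)} α` for all `α, β ∈ D`, there is a unique
alternating `(k+1)`-linear map `ω` on `S := λ(D)` with
`ω(λ(α), Y₁, …, Y_k) = α(Y₁, …, Y_k)` for all `α ∈ D`, `Yᵢ ∈ S`.  In particular, if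
`λ(α) = λ(α′)` then `α` and `α′` agree on all `k`-tuples of vectors from `S`. -/
theorem leafwise_form_well_defined
    {V : Type*} [AddCommGroup V] [Module ℝ V] [FiniteDimensional ℝ V]
    {n : ℕ} (D : Submodule ℝ (Form V (n + 1))) (lam : D →ₗ[ℝ] V)
    (hskew : ∀ α β : D, iota (lam α) (β : Form V (n + 1)) =
      -iota (lam β) (α : Form V (n + 1))) :
    (∃! ω : AlternatingMap ℝ (LinearMap.range lam) ℝ (Fin (n + 2)),
      ∀ (α : D) (Y : Fin (n + 1) → LinearMap.range lam),
        ω (Fin.cons ⟨lam α, LinearMap.mem_range_self lam α⟩ Y) =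
          (α : Form V (n + 1)) (fun i => (Y i : V))) ∧
    (∀ α α' : D, lam α = lam α' →
      ∀ Y : Fin (n + 1) → LinearMap.range lam,
        (α : Form V (n + 1)) (fun i => (Y i : V)) =
          (α' : Form V (n + 1)) (fun i => (Y i : V))) := by
  have hwd : ∀ α α' : D, lam α = lam α' → ∀ Y : Fin (n + 1) → LinearMap.range lam,
      (α : Form V (n + 1)) (fun i => (Y i : V)) =
        (α' : Form V (n + 1)) (fun i => (Y i : V)) := by
    intro α α' h Y
    have h0 : lam (α - α') = 0 := 
      (LinearMap.map_sub lam α α').trans (sub_eq_zero.mpr h)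
    have h1 := eq_zero_of_mem_ker hskew h0 Y
    rwa [Submodule.coe_sub, AlternatingMap.sub_apply, sub_eq_zero] at h1
  refine ⟨?_, hwd⟩
  have hself : ∀ α : D, iota (lam α) (α : Form V (n + 1)) = 0 := fun α => by
    ext Y
    exact self_eq_neg.mp (DFunLike.congr_fun (hskew α α) Y)
  obtain ⟨s, hs⟩ := lam.rangeRestrict.exists_rightInverse_of_surjective
    lam.range_rangeRestrict
  have hs' : ∀ X : LinearMap.range lam, lam (s X) = X := fun X =>
    congrArg Subtype.val (DFunLike.congr_fun hs X)
  let g : LinearMap.range lam →ₗ[ℝ]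
      MultilinearMap ℝ (fun _ : Fin (n + 1) => LinearMap.range lam) ℝ :=
    { toFun := fun X =>
        ((s X : Form V (n + 1)).compLinearMap (LinearMap.range lam).subtype).toMultilinearMap
      map_add' := fun X X' => by ext Y; simp
      map_smul' := fun c X => by ext Y; simp }
  let G : MultilinearMap ℝ (fun _ : Fin (n + 2) => LinearMap.range lam) ℝ :=
    LinearMap.uncurryLeft (M := fun _ => LinearMap.range lam) g
  have hG : ∀ v : Fin (n + 2) → LinearMap.range lam,
      G v = (s (v 0) : Form V (n + 1)) (fun i => (v i.succ : V)) := fun v => rfl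
  have hzero : ∀ (v : Fin (n + 2) → LinearMap.range lam) (j : Fin (n + 1)),
      v 0 = v j.succ → G v = 0 := fun v j h => by
    rw [hG]
    exact eq_zero_of_iota_eq_zero (hself _) (j := j) (by rw [hs', h])
  let ω : AlternatingMap ℝ (LinearMap.range lam) ℝ (Fin (n + 2)) :=
    { G with
      map_eq_zero_of_eq' := fun v i j h hij => by
        change G v = 0
        cases i using Fin.cases with
        | zero =>
          cases j using Fin.cases with
          | zero => exact absurd rfl hij
          | succ j => exact hzero v j h
        | succ i =>
          cases j using Fin.cases with
          | zero => exact hzero v i h.symm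
          | succ j =>
            rw [hG]
            exact AlternatingMap.map_eq_zero_of_eq _ _ (congrArg Subtype.val h)
              fun hc => hij (congrArg Fin.succ hc) }
  have hω : ∀ (α : D) (Y : Fin (n + 1) → LinearMap.range lam),
      ω (Fin.cons ⟨lam α, LinearMap.mem_range_self lam α⟩ Y) =
        (α : Form V (n + 1)) (fun i => (Y i : V)) := fun α Y =>
    hwd _ _ (hs' ⟨lam α, LinearMap.mem_range_self lam α⟩) Y
  refine ⟨ω, hω, fun ω' hω' => ?_⟩
  ext v
  obtain ⟨α, hα⟩ := (v 0).2
  have hv : v = Fin.cons ⟨lam α, LinearMap.mem_range_self lam α⟩ (Fin.tail v) := by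
    rw [← Fin.cons_self_tail v]
    congr 1
    exact Subtype.ext hα.symm
  rw [hv, hω', hω]
end

section
/- Let V₁, V₂ be finite-dimensional real vector spaces, k ≥ 1, and for i = 1,2 let L_i ⊆ V_i ⊕ Ω^k(V_i) be an isotropic subspace with L_i^⊥ ∩ V_i = {0}. Let V = V₁ × V₂ with projections p_i : V → V_i, and let p_i^* : Ω^k(V_i) → Ω^k(V) denote precomposition with p_i in every argument. Then the subspace L := {((X,Y), p₁^*α + p₂^*β) : (X,α) ∈ L₁, (Y,β) ∈ L₂} of V ⊕ Ω^k(V) is isotropic and satisfies L^⊥ ∩ V = {0}. -/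
/-- The orthogonal of a set `L ⊆ W^(k)` with respect to the pairing. -/
def perpS {V : Type*} [AddCommGroup V] [Module ℝ V] {k : ℕ}
    (L : Set (V × Form V (k + 1))) : Set (V × Form V (k + 1)) :=
  {w | ∀ l ∈ L, pairW w l = 0}

theorem iota_compLinearMap {V W : Type*} [AddCommGroup V] [Module ℝ V] [AddCommGroup W]
    [Module ℝ W] {k : ℕ} (f : V →ₗ[ℝ] W) (Z : V) (α : Form W (k + 1)) :
    iota Z (α.compLinearMap f) = (iota (f Z) α).compLinearMap f :=
  AlternatingMap.curryLeft_compLinearMap f α Z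

/-- The pairing is compatible with direct products. -/
theorem pairW_prod {V₁ V₂ : Type*} [AddCommGroup V₁] [Module ℝ V₁]
    [AddCommGroup V₂] [Module ℝ V₂] {k : ℕ} (X X' : V₁) (Y Y' : V₂)
    (α α' : Form V₁ (k + 1)) (β β' : Form V₂ (k + 1)) :
    pairW ((X, Y), α.compLinearMap (LinearMap.fst ℝ V₁ V₂) +
        β.compLinearMap (LinearMap.snd ℝ V₁ V₂))
      ((X', Y'), α'.compLinearMap (LinearMap.fst ℝ V₁ V₂) +
        β'.compLinearMap (LinearMap.snd ℝ V₁ V₂)) =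
      (pairW (X, α) (X', α')).compLinearMap (LinearMap.fst ℝ V₁ V₂) +
        (pairW (Y, β) (Y', β')).compLinearMap (LinearMap.snd ℝ V₁ V₂) := by
  have iota_add (Z : V₁ × V₂) (γ δ : Form (V₁ × V₂) (k + 1)) :
      iota Z (γ + δ) = iota Z γ + iota Z δ := rfl
  simp only [pairW, iota_add, iota_compLinearMap, LinearMap.fst_apply, LinearMap.snd_apply,
    AlternatingMap.add_compLinearMap]
  abel

theorem pairW_zero_right {V : Type*} [AddCommGroup V] [Module ℝ V] {k : ℕ}
    (w : V × Form V (k + 1)) : pairW w (0, 0) = 0 := by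
  ext v
  simp [pairW, iota]

/-- The direct product of two isotropic, nondegenerate (`L^⊥ ∩ V = 0`)
subspaces `Lᵢ ⊆ Vᵢ ⊕ Ω^k(Vᵢ)` (`k = n + 1 ≥ 1`) is again isotropic and nondegenerate
in `(V₁ × V₂) ⊕ Ω^k(V₁ × V₂)`, where forms on the factors are pulled back by the
projections. -/
theorem product_of_kPoisson_is_kPoisson
    {V₁ V₂ : Type*} [AddCommGroup V₁] [Module ℝ V₁] [FiniteDimensional ℝ V₁]
    [AddCommGroup V₂] [Module ℝ V₂] [FiniteDimensional ℝ V₂]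
    {n : ℕ} (L₁ : Submodule ℝ (V₁ × Form V₁ (n + 1)))
    (L₂ : Submodule ℝ (V₂ × Form V₂ (n + 1)))
    (h₁iso : (L₁ : Set (V₁ × Form V₁ (n + 1))) ⊆ perpS (L₁ : Set (V₁ × Form V₁ (n + 1))))
    (h₂iso : (L₂ : Set (V₂ × Form V₂ (n + 1))) ⊆ perpS (L₂ : Set (V₂ × Form V₂ (n + 1))))
    (h₁nd : ∀ X : V₁, (X, (0 : Form V₁ (n + 1))) ∈
      perpS (L₁ : Set (V₁ × Form V₁ (n + 1))) → X = 0)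
    (h₂nd : ∀ Y : V₂, (Y, (0 : Form V₂ (n + 1))) ∈
      perpS (L₂ : Set (V₂ × Form V₂ (n + 1))) → Y = 0)
    (L : Set ((V₁ × V₂) × Form (V₁ × V₂) (n + 1)))
    (hL : L = {w | ∃ (X : V₁) (α : Form V₁ (n + 1)) (Y : V₂) (β : Form V₂ (n + 1)),
      (X, α) ∈ L₁ ∧ (Y, β) ∈ L₂ ∧
      w = ((X, Y), α.compLinearMap (LinearMap.fst ℝ V₁ V₂) +
        β.compLinearMap (LinearMap.snd ℝ V₁ V₂))}) :
    L ⊆ perpS L ∧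
      (∀ Z : V₁ × V₂, (Z, (0 : Form (V₁ × V₂) (n + 1))) ∈ perpS L → Z = 0) := by
  subst hL
  constructor
  · rintro _ ⟨X, α, Y, β, hα, hβ, rfl⟩ _ ⟨X', α', Y', β', hα', hβ', rfl⟩
    rw [pairW_prod, h₁iso hα _ hα', h₂iso hβ _ hβ', AlternatingMap.zero_compLinearMap,
      AlternatingMap.zero_compLinearMap, add_zero]
  · rintro ⟨X, Y⟩ hZ
    have key (X' : V₁) (α : Form V₁ (n + 1)) (Y' : V₂) (β : Form V₂ (n + 1))
        (hα : (X', α) ∈ L₁) (hβ : (Y', β) ∈ L₂) :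
        (pairW (X, 0) (X', α)).compLinearMap (LinearMap.fst ℝ V₁ V₂) +
          (pairW (Y, 0) (Y', β)).compLinearMap (LinearMap.snd ℝ V₁ V₂) = 0 := by
      rw [← pairW_prod, AlternatingMap.zero_compLinearMap, AlternatingMap.zero_compLinearMap,
        add_zero]
      exact hZ _ ⟨X', α, Y', β, hα, hβ, rfl⟩
    refine Prod.ext (h₁nd X ?_) (h₂nd Y ?_)
    · rintro ⟨X', α⟩ hα
      have h := key X' α 0 0 hα L₂.zero_mem
      rw [pairW_zero_right, AlternatingMap.zero_compLinearMap, add_zero] at h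
      exact AlternatingMap.compLinearMap_injective _ LinearMap.fst_surjective
        (h.trans (AlternatingMap.zero_compLinearMap _).symm)
    · rintro ⟨Y', β⟩ hβ
      have h := key 0 0 Y' β L₁.zero_mem hβ
      rw [pairW_zero_right, AlternatingMap.zero_compLinearMap, zero_add] at h
      exact AlternatingMap.compLinearMap_injective _ LinearMap.snd_surjective
        (h.trans (AlternatingMap.zero_compLinearMap _).symm)
end
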